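/- Consider the triple of generators (v_{ij}, v_{ij}, v_{ji}) of kQ̄_n with i ≠ j. Then the quasi-Poisson property {{v_{ij},v_{ij},v_{ji}}} = {{v_{ij},v_{ij},v_{ji}}}_qP holds if and only if the conditions in the applicable case below are all satisfied: (i) when i < j: for all i < b < j one has κ_b^{(j,i)}(α^{(j)}_{ib} − 1/2) = 0, κ_b^{(j,i)}(μ^{(j)}_{ib} + 1/2) = 0, and κ_b^{(j,i)} ν^{(j)}_{ib} = 0; (ii) when i > j: for all i > a > j one has κ_a^{(i,j)}(β^{(i)}_{aj} − 1/2) = 0, κ_a^{(i,j)}(μ^{(i)}_{aj} + 1/2) = 0, and κ_a^{(i,j)} ν^{(i)}_{aj} = 0. -/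

import Mathlib

open TensorProduct

namespace NCQP

variable (𝕜 : Type) [Field 𝕜] [CharZero 𝕜]

/-- A double bracket on a `𝕜`-algebra `A`: a bilinear map `A × A → A ⊗ A` satisfying
cyclic antisymmetry and the Leibniz rule in its second argument (for the outer bimodule
structure on `A ⊗ A`). -/
structure DoubleBracket (A : Type) [Ring A] [Algebra 𝕜 A] where
  br : A →ₗ[𝕜] A →ₗ[𝕜] A ⊗[𝕜] A
  cyclic : ∀ a b : A, br b a = - (TensorProduct.comm 𝕜 A A) (br a b)
  leibniz : ∀ a b c : A,
    br a (b * c) = br a b * ((1 : A) ⊗ₜ[𝕜] c) + ((b : A) ⊗ₜ[𝕜] (1 : A)) * br a c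

variable {𝕜}
variable {A : Type} [Ring A] [Algebra 𝕜 A]

/-- The permutation `τ_(132)` on `A ⊗ A ⊗ A`, sending `a ⊗ b ⊗ c` to `b ⊗ c ⊗ a`. -/
noncomputable def tau132 (𝕜 : Type) [Field 𝕜] (A : Type) [Ring A] [Algebra 𝕜 A] :
    (A ⊗[𝕜] (A ⊗[𝕜] A)) ≃ₗ[𝕜] (A ⊗[𝕜] (A ⊗[𝕜] A)) :=
  (TensorProduct.comm 𝕜 A (A ⊗[𝕜] A)).trans (TensorProduct.assoc 𝕜 A A A)

/-- The permutation `τ_(123)` on `A ⊗ A ⊗ A`, sending `a ⊗ b ⊗ c` to `c ⊗ a ⊗ b`. -/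
noncomputable def tau123 (𝕜 : Type) [Field 𝕜] (A : Type) [Ring A] [Algebra 𝕜 A] :
    (A ⊗[𝕜] (A ⊗[𝕜] A)) ≃ₗ[𝕜] (A ⊗[𝕜] (A ⊗[𝕜] A)) :=
  (tau132 𝕜 A).trans (tau132 𝕜 A)

/-- Extension of a linear map `φ : A → A ⊗ A` to `A ⊗ A → A ⊗ A ⊗ A` acting on the
left factor: `b ⊗ c ↦ φ(b) ⊗ c`. -/
noncomputable def extL (𝕜 : Type) [Field 𝕜] (A : Type) [Ring A] [Algebra 𝕜 A]
    (φ : A →ₗ[𝕜] A ⊗[𝕜] A) : A ⊗[𝕜] A →ₗ[𝕜] A ⊗[𝕜] (A ⊗[𝕜] A) :=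
  (TensorProduct.assoc 𝕜 A A A).toLinearMap.comp (LinearMap.rTensor A φ)

/-- The triple bracket `{{a,b,c}}` associated with a double bracket. -/
noncomputable def tripleBr (D : DoubleBracket 𝕜 A) (a b c : A) : A ⊗[𝕜] (A ⊗[𝕜] A) :=
  extL 𝕜 A (D.br a) (D.br b c) + tau123 𝕜 A (extL 𝕜 A (D.br b) (D.br c a))
    + tau132 𝕜 A (extL 𝕜 A (D.br c) (D.br a b))

/-- The quasi-Poisson trivector term `{{a,b,c}}_qP` associated with a family of
orthogonal idempotents `e`. -/
noncomputable def tripleQP {I : Type} [Fintype I] (e : I → A) (a b c : A) :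
    A ⊗[𝕜] (A ⊗[𝕜] A) :=
  (4 : 𝕜)⁻¹ • ∑ s : I,
    ( (c * e s * a) ⊗ₜ[𝕜] ((e s * b) ⊗ₜ[𝕜] (e s))
    - (c * e s * a) ⊗ₜ[𝕜] ((e s) ⊗ₜ[𝕜] (b * e s))
    - (c * e s) ⊗ₜ[𝕜] ((a * e s * b) ⊗ₜ[𝕜] (e s))
    + (c * e s) ⊗ₜ[𝕜] ((a * e s) ⊗ₜ[𝕜] (b * e s))
    - (e s * a) ⊗ₜ[𝕜] ((e s * b) ⊗ₜ[𝕜] (e s * c))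
    + (e s * a) ⊗ₜ[𝕜] ((e s) ⊗ₜ[𝕜] (b * e s * c))
    + (e s) ⊗ₜ[𝕜] ((a * e s * b) ⊗ₜ[𝕜] (e s * c))
    - (e s) ⊗ₜ[𝕜] ((a * e s) ⊗ₜ[𝕜] (b * e s * c)) )

variable (𝕜)

/-- Generators of the path algebra of the quiver `Q̄_n`: one idempotent `E i` per vertex
and one arrow `V i j : j → i` for each ordered pair of distinct vertices. -/
inductive QGen (n : ℕ) : Type
  | E : Fin n → QGen n
  | V : Fin n → Fin n → QGen n

/-- The defining relations of the path algebra of `Q̄_n`. -/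
inductive QRel (n : ℕ) : FreeAlgebra 𝕜 (QGen n) → FreeAlgebra 𝕜 (QGen n) → Prop
  | orth (i j : Fin n) :
      QRel n (FreeAlgebra.ι 𝕜 (QGen.E i) * FreeAlgebra.ι 𝕜 (QGen.E j))
        (if i = j then FreeAlgebra.ι 𝕜 (QGen.E i) else 0)
  | sum_one :
      QRel n (∑ i : Fin n, FreeAlgebra.ι 𝕜 (QGen.E i)) 1
  | supp (i j : Fin n) :
      QRel n (FreeAlgebra.ι 𝕜 (QGen.V i j))
        (FreeAlgebra.ι 𝕜 (QGen.E i) * FreeAlgebra.ι 𝕜 (QGen.V i j) *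
          FreeAlgebra.ι 𝕜 (QGen.E j))
  | diag (i : Fin n) :
      QRel n (FreeAlgebra.ι 𝕜 (QGen.V i i)) 0

/-- The path algebra `𝕜 Q̄_n` of the double of an ordering of the complete `n`-partite
graph on `n` vertices. -/
abbrev PathAlg (n : ℕ) : Type := RingQuot (QRel 𝕜 n)

/-- The vertex idempotents `e i` of `𝕜 Q̄_n`. -/
noncomputable def pe (n : ℕ) (i : Fin n) : PathAlg 𝕜 n :=
  RingQuot.mkAlgHom 𝕜 (QRel 𝕜 n) (FreeAlgebra.ι 𝕜 (QGen.E i))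

/-- The arrows `v i j : j → i` of `𝕜 Q̄_n`. -/
noncomputable def pv (n : ℕ) (i j : Fin n) : PathAlg 𝕜 n :=
  RingQuot.mkAlgHom 𝕜 (QRel 𝕜 n) (FreeAlgebra.ι 𝕜 (QGen.V i j))

/-- The data of coefficient matrices `α, β, μ, ν` and scalars `κ`, together with a
`B`-linear double bracket on the path algebra `𝕜 Q̄_n` whose values on the generators
are given by the formulas (vv0)–(vvopp); `α s i j` stands for `α^{(s)}_{ij}` and
`κ i a j` stands for `κ_a^{(i,j)}`. -/
structure BracketData (n : ℕ) where
  α : Fin n → Fin n → Fin n → 𝕜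
  β : Fin n → Fin n → Fin n → 𝕜
  μ : Fin n → Fin n → Fin n → 𝕜
  ν : Fin n → Fin n → Fin n → 𝕜
  κ : Fin n → Fin n → Fin n → 𝕜
  D : DoubleBracket 𝕜 (PathAlg 𝕜 n)
  hα_skew : ∀ s i j, α s i j = - α s j i
  hα_row : ∀ s j, α s s j = 0
  hα_col : ∀ s j, α s j s = 0
  hβ_skew : ∀ s i j, β s i j = - β s j i
  hβ_row : ∀ s j, β s s j = 0
  hβ_col : ∀ s j, β s j s = 0
  hμ_diag : ∀ s i, μ s i i = 0
  hμ_row : ∀ s j, μ s s j = 0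
  hμ_col : ∀ s j, μ s j s = 0
  hν_diag : ∀ s i, ν s i i = 0
  hν_row : ∀ s j, ν s s j = 0
  hν_col : ∀ s j, ν s j s = 0
  hκ : ∀ i a j, ¬ (j < a ∧ a < i) → κ i a j = 0
  /-- the bracket vanishes on the idempotents, i.e. it is `B`-linear -/
  hB : ∀ s, D.br (pe 𝕜 n s) = 0
  hvv : ∀ i j, D.br (pv 𝕜 n i j) (pv 𝕜 n i j) = 0
  hdisj : ∀ i j p q, i ≠ p → i ≠ q → j ≠ p → j ≠ q →
    D.br (pv 𝕜 n i j) (pv 𝕜 n p q) = 0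
  hbr_α : ∀ i j l, i ≠ j → l ≠ j →
    D.br (pv 𝕜 n i j) (pv 𝕜 n l j) = α j i l • (pv 𝕜 n l j ⊗ₜ[𝕜] pv 𝕜 n i j)
  hbr_β : ∀ i j l, j ≠ i → l ≠ i →
    D.br (pv 𝕜 n i j) (pv 𝕜 n i l) = β i j l • (pv 𝕜 n i j ⊗ₜ[𝕜] pv 𝕜 n i l)
  hbr_μν : ∀ i j l, i ≠ j → l ≠ j → i ≠ l →
    D.br (pv 𝕜 n i j) (pv 𝕜 n j l) =
      μ j i l • (pe 𝕜 n j ⊗ₜ[𝕜] (pv 𝕜 n i j * pv 𝕜 n j l))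
      + ν j i l • (pe 𝕜 n j ⊗ₜ[𝕜] pv 𝕜 n i l)
  hbr_μν' : ∀ i j l, i ≠ j → l ≠ i → l ≠ j →
    D.br (pv 𝕜 n i j) (pv 𝕜 n l i) =
      - (μ i l j • ((pv 𝕜 n l i * pv 𝕜 n i j) ⊗ₜ[𝕜] pe 𝕜 n i))
      - ν i l j • (pv 𝕜 n l j ⊗ₜ[𝕜] pe 𝕜 n i)
  hbr_loop : ∀ i j, i ≠ j →
    D.br (pv 𝕜 n i j) (pv 𝕜 n j i) =
      (if j < i then (1 : 𝕜) else -1) •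
        ( pe 𝕜 n j ⊗ₜ[𝕜] pe 𝕜 n i
          + (2 : 𝕜)⁻¹ • ((pv 𝕜 n j i * pv 𝕜 n i j) ⊗ₜ[𝕜] pe 𝕜 n i)
          + (2 : 𝕜)⁻¹ • (pe 𝕜 n j ⊗ₜ[𝕜] (pv 𝕜 n i j * pv 𝕜 n j i)) )
      + ∑ a : Fin n, κ i a j • (pe 𝕜 n j ⊗ₜ[𝕜] (pv 𝕜 n i a * pv 𝕜 n a i))
      - ∑ b : Fin n, κ j b i • ((pv 𝕜 n j b * pv 𝕜 n b j) ⊗ₜ[𝕜] pe 𝕜 n i)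

section TripleTensor

variable {K : Type} [Field K] {A : Type} [Ring A] [Algebra K A]

/-- The product of three linear functionals, as a functional on the triple tensor product. -/
noncomputable def tensorFunctional (f g h : A →ₗ[K] K) :
    A ⊗[K] (A ⊗[K] A) →ₗ[K] K :=
  (LinearMap.mul' K K).comp
    (TensorProduct.map f ((LinearMap.mul' K K).comp (TensorProduct.map g h)))

@[simp] lemma tensorFunctional_tmul (f g h : A →ₗ[K] K)
    (a b c : A) : tensorFunctional f g h (a ⊗ₜ (b ⊗ₜ c)) = f a * (g b * h c) := by
  simp [tensorFunctional]

@[simp] lemma extL_tmul (φ : A →ₗ[K] A ⊗[K] A) (a b : A) :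
    extL K A φ (a ⊗ₜ b) = TensorProduct.assoc K A A A (φ a ⊗ₜ b) := rfl

@[simp] lemma tau123_tmul (a b c : A) :
    tau123 K A (a ⊗ₜ (b ⊗ₜ c)) = c ⊗ₜ (a ⊗ₜ b) := rfl

lemma tau123_assoc_tmul (t : A ⊗[K] A) (c : A) :
    tau123 K A (TensorProduct.assoc K A A A (t ⊗ₜ c)) = c ⊗ₜ t := by
  induction t with
  | zero => simp
  | tmul a b => rfl
  | add t u ht hu => rw [TensorProduct.add_tmul, map_add, map_add, ht, hu, TensorProduct.tmul_add]

/-- The contribution of a loop `w` at the head of `x` to the defect of the quasi-Poisson property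
on `(x, x, y)`, where `p` and `q` are the idempotents at the tail and the head of `x`. -/
noncomputable def lowerMap (D : DoubleBracket K A) (x p q : A) : A →ₗ[K] A ⊗[K] (A ⊗[K] A) where
  toFun w := (2 : K)⁻¹ • (p ⊗ₜ ((w * x) ⊗ₜ q)) - (2 : K)⁻¹ • (p ⊗ₜ (x ⊗ₜ w)) - p ⊗ₜ D.br x w
  map_add' v w := by
    simp only [add_mul, TensorProduct.add_tmul, TensorProduct.tmul_add, map_add]
    module
  map_smul' c w := by
    simp only [smul_mul_assoc, ← TensorProduct.smul_tmul', TensorProduct.tmul_smul, map_smul,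
      RingHom.id_apply]
    module

/-- The contribution of a loop `w` at the tail of `x` to the defect of the quasi-Poisson property
on `(x, x, y)`, where `p` and `q` are the idempotents at the tail and the head of `x`. -/
noncomputable def upperMap (D : DoubleBracket K A) (x p q : A) : A →ₗ[K] A ⊗[K] (A ⊗[K] A) where
  toFun w := TensorProduct.assoc K A A A (D.br x w ⊗ₜ q) - (2 : K)⁻¹ • (w ⊗ₜ (x ⊗ₜ q))
    + (2 : K)⁻¹ • (p ⊗ₜ ((x * w) ⊗ₜ q))
  map_add' v w := by
    simp only [mul_add, TensorProduct.add_tmul, TensorProduct.tmul_add, map_add]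
    module
  map_smul' c w := by
    simp only [mul_smul_comm, ← TensorProduct.smul_tmul', TensorProduct.tmul_smul, map_smul,
      RingHom.id_apply]
    module

lemma lowerMap_apply (D : DoubleBracket K A) (x p q w : A) :
    lowerMap D x p q w = (2 : K)⁻¹ • (p ⊗ₜ ((w * x) ⊗ₜ q)) - (2 : K)⁻¹ • (p ⊗ₜ (x ⊗ₜ w))
      - p ⊗ₜ D.br x w := rfl

lemma upperMap_apply (D : DoubleBracket K A) (x p q w : A) :
    upperMap D x p q w = TensorProduct.assoc K A A A (D.br x w ⊗ₜ q)
      - (2 : K)⁻¹ • (w ⊗ₜ (x ⊗ₜ q)) + (2 : K)⁻¹ • (p ⊗ₜ ((x * w) ⊗ₜ q)) := rfl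

lemma tripleBr_of_br_eq [CharZero K] (D : DoubleBracket K A) {x y p q k l : A} {s : K}
    (hs : s = 1 ∧ l = 0 ∨ s = -1 ∧ k = 0) (hxx : D.br x x = 0) (hp : D.br x p = 0)
    (hq : D.br x q = 0) (hxp : x * p = x)
    (hxy : D.br x y = s • (p ⊗ₜ q + (2 : K)⁻¹ • ((y * x) ⊗ₜ q) + (2 : K)⁻¹ • (p ⊗ₜ (x * y)))
      + p ⊗ₜ k - l ⊗ₜ q) (hqx : q * x = x) :
    tripleBr D x x y = (4 : K)⁻¹ • ((y * x) ⊗ₜ (x ⊗ₜ q) - p ⊗ₜ (x ⊗ₜ (x * y)))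
      + lowerMap D x p q k - upperMap D x p q l := by
  have hr (c : A) : D.br x (c * x) = D.br x c * (1 ⊗ₜ x) := by
    rw [D.leibniz, hxx, mul_zero, add_zero]
  have hl (c : A) : D.br x (x * c) = (x ⊗ₜ 1) * D.br x c := by
    rw [D.leibniz, hxx, zero_mul, zero_add]
  rw [lowerMap_apply, upperMap_apply, tripleBr, hxx, D.cyclic x y, hxy]
  rcases hs with ⟨rfl, rfl⟩ | ⟨rfl, rfl⟩ <;>
  · simp only [map_add, map_sub, map_neg, map_smul, map_zero, extL_tmul,
      TensorProduct.comm_tmul, hp, hq, hr, hl, hxy, add_mul, mul_add, sub_mul, mul_sub,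
      smul_mul_assoc, mul_smul_comm, Algebra.TensorProduct.tmul_mul_tmul, one_mul, mul_one,
      hxp, hqx, TensorProduct.add_tmul, TensorProduct.sub_tmul, ← TensorProduct.smul_tmul',
      TensorProduct.zero_tmul, TensorProduct.tmul_zero, TensorProduct.assoc_tmul,
      tau123_tmul, tau123_assoc_tmul, mul_assoc, zero_mul, mul_zero]
    match_scalars <;> norm_num

end TripleTensor

section PathAlgebra

variable {K : Type} [Field K] {n : ℕ}

lemma pe_mul_pe (i j : Fin n) : pe K n i * pe K n j = if i = j then pe K n i else 0 := by
  have h := RingQuot.mkAlgHom_rel K (QRel.orth (𝕜 := K) i j)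
  rw [map_mul] at h
  refine h.trans ?_
  split_ifs
  · rfl
  · exact map_zero _

lemma pv_eq (i j : Fin n) : pe K n i * pv K n i j * pe K n j = pv K n i j := by
  have h := RingQuot.mkAlgHom_rel K (QRel.supp (𝕜 := K) i j)
  rw [map_mul, map_mul] at h
  exact h.symm

lemma pe_mul_pv (s i j : Fin n) : pe K n s * pv K n i j = if s = i then pv K n i j else 0 := by
  rw [← pv_eq i j, ← mul_assoc, ← mul_assoc, pe_mul_pe]
  split_ifs with h
  · rw [h]
  · simp

lemma pv_mul_pe (s i j : Fin n) : pv K n i j * pe K n s = if j = s then pv K n i j else 0 := by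
  rw [← pv_eq i j, mul_assoc, pe_mul_pe]
  split_ifs <;> simp

lemma pv_mul_pv_of_ne {j k : Fin n} (hjk : j ≠ k) (i l : Fin n) :
    pv K n i j * pv K n k l = 0 := by
  rw [← pv_eq k l, ← mul_assoc, ← mul_assoc, pv_mul_pe, if_neg hjk, zero_mul, zero_mul]

/-- The representation of the path algebra on `K ^ n` in which every vertex space is a line
and the arrow `v i j` acts as multiplication by `X i j`. -/
noncomputable def lineRep (X : Fin n → Fin n → K) : PathAlg K n →ₐ[K] Matrix (Fin n) (Fin n) K :=
  RingQuot.liftAlgHom K ⟨FreeAlgebra.lift K fun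
    | .E i => Matrix.single i i 1
    | .V i j => Matrix.single i j (if i = j then 0 else X i j), by
      intro x y h
      induction h with
      | orth i j =>
        split_ifs with h
        · subst h; simp
        · simp [Matrix.single_mul_single_of_ne _ _ _ _ h]
      | sum_one =>
        simp only [map_sum, FreeAlgebra.lift_ι_apply, map_one]
        ext i j
        simp [Matrix.sum_apply, Matrix.single_apply, Matrix.one_apply, ite_and]
      | supp i j => simp
      | diag i => simp⟩

@[simp] lemma lineRep_pe (X : Fin n → Fin n → K) (i : Fin n) :
    lineRep X (pe K n i) = Matrix.single i i 1 := by
  simp [lineRep, pe]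

@[simp] lemma lineRep_pv (X : Fin n → Fin n → K) (i j : Fin n) :
    lineRep X (pv K n i j) = Matrix.single i j (if i = j then 0 else X i j) := by
  simp [lineRep, pv]

/-- The arrow weights equal to `1` on the arrows in `s` and `0` elsewhere. -/
def arrowWeight (K : Type) [Field K] (s : Finset (Fin n × Fin n)) (i j : Fin n) : K :=
  if (i, j) ∈ s then 1 else 0

/-- The matrix coefficient of `lineRep X` at the entry `(p, q)`. -/
noncomputable def coeffRep (X : Fin n → Fin n → K) (p q : Fin n) : PathAlg K n →ₗ[K] K :=
  (Matrix.entryLinearMap K K p q).comp (lineRep X).toLinearMap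

lemma coeffRep_apply (X : Fin n → Fin n → K) (p q : Fin n) (w : PathAlg K n) :
    coeffRep X p q w = lineRep X w p q := rfl

lemma tripleQP_arrow (i j : Fin n) (hij : i ≠ j) :
    tripleQP (𝕜 := K) (pe K n) (pv K n i j) (pv K n i j) (pv K n j i) =
      (4 : K)⁻¹ • ((pv K n j i * pv K n i j) ⊗ₜ (pv K n i j ⊗ₜ pe K n i)
        - pe K n j ⊗ₜ (pv K n i j ⊗ₜ (pv K n i j * pv K n j i))) := by
  unfold tripleQP
  congr 1
  rw [Finset.sum_eq_add i j hij]
  · simp [pe_mul_pv, pv_mul_pe, pv_mul_pv_of_ne, hij, hij.symm, sub_eq_add_neg]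
  · rintro s - ⟨h1, h2⟩
    simp [pe_mul_pv, pv_mul_pe, h1, h2, h1.symm, h2.symm]
  · simp
  · simp

end PathAlgebra

namespace BracketData

variable {K : Type} [Field K] {n : ℕ} (S : BracketData K n)

/-- The part of the defect of the quasi-Poisson property on `(v i j, v i j, v j i)` carried by
`κ i a j`. -/
noncomputable def lowerDefect (i j a : Fin n) :
    PathAlg K n ⊗[K] (PathAlg K n ⊗[K] PathAlg K n) :=
  (S.κ i a j * (S.β i a j - 2⁻¹)) •
      (pe K n j ⊗ₜ (pv K n i j ⊗ₜ (pv K n i a * pv K n a i)))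
    + (S.κ i a j * (S.μ i a j + 2⁻¹)) •
      (pe K n j ⊗ₜ ((pv K n i a * pv K n a i * pv K n i j) ⊗ₜ pe K n i))
    + (S.κ i a j * S.ν i a j) • (pe K n j ⊗ₜ ((pv K n i a * pv K n a j) ⊗ₜ pe K n i))

/-- The part of the defect of the quasi-Poisson property on `(v i j, v i j, v j i)` carried by
`κ j b i`. -/
noncomputable def upperDefect (i j b : Fin n) :
    PathAlg K n ⊗[K] (PathAlg K n ⊗[K] PathAlg K n) :=
  (S.κ j b i * (S.α j i b - 2⁻¹)) •
      ((pv K n j b * pv K n b j) ⊗ₜ (pv K n i j ⊗ₜ pe K n i))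
    + (S.κ j b i * (S.μ j i b + 2⁻¹)) •
      (pe K n j ⊗ₜ ((pv K n i j * pv K n j b * pv K n b j) ⊗ₜ pe K n i))
    + (S.κ j b i * S.ν j i b) • (pe K n j ⊗ₜ ((pv K n i b * pv K n b j) ⊗ₜ pe K n i))

lemma br_lower {i j a : Fin n} (hij : i ≠ j) (hai : a ≠ i) (haj : a ≠ j) :
    S.D.br (pv K n i j) (pv K n i a * pv K n a i) =
      - (S.β i a j • (pv K n i j ⊗ₜ (pv K n i a * pv K n a i)))
      - S.μ i a j • ((pv K n i a * pv K n a i * pv K n i j) ⊗ₜ pe K n i)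
      - S.ν i a j • ((pv K n i a * pv K n a j) ⊗ₜ pe K n i) := by
  rw [S.D.leibniz, S.hbr_β i j a hij.symm hai, S.hbr_μν' i j a hij hai haj, S.hβ_skew i j a]
  simp only [mul_sub, mul_neg, smul_mul_assoc, mul_smul_comm,
    Algebra.TensorProduct.tmul_mul_tmul, mul_one, one_mul, mul_assoc]
  module

lemma br_upper {i j b : Fin n} (hij : i ≠ j) (hbi : b ≠ i) (hbj : b ≠ j) :
    S.D.br (pv K n i j) (pv K n j b * pv K n b j) =
      S.α j i b • ((pv K n j b * pv K n b j) ⊗ₜ pv K n i j)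
      + S.μ j i b • (pe K n j ⊗ₜ (pv K n i j * pv K n j b * pv K n b j))
      + S.ν j i b • (pe K n j ⊗ₜ (pv K n i b * pv K n b j)) := by
  rw [S.D.leibniz, S.hbr_μν i j b hij hbj hbi.symm, S.hbr_α i j b hij hbj]
  simp only [add_mul, smul_mul_assoc, mul_smul_comm,
    Algebra.TensorProduct.tmul_mul_tmul, mul_one, one_mul]
  module

lemma br_pe (a : PathAlg K n) (s : Fin n) : S.D.br a (pe K n s) = 0 := by
  rw [S.D.cyclic (pe K n s) a, S.hB]
  simp

lemma lowerDefect_eq {i j : Fin n} (hij : i ≠ j) (a : Fin n) :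
    S.lowerDefect i j a = S.κ i a j •
      lowerMap S.D (pv K n i j) (pe K n j) (pe K n i) (pv K n i a * pv K n a i) := by
  by_cases h : j < a ∧ a < i
  · rw [lowerMap_apply, S.br_lower hij h.2.ne h.1.ne', lowerDefect]
    simp only [TensorProduct.tmul_sub, TensorProduct.tmul_neg, TensorProduct.tmul_smul]
    module
  · simp [lowerDefect, S.hκ i a j h]

lemma upperDefect_eq {i j : Fin n} (hij : i ≠ j) (b : Fin n) :
    S.upperDefect i j b = S.κ j b i •
      upperMap S.D (pv K n i j) (pe K n j) (pe K n i) (pv K n j b * pv K n b j) := by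
  by_cases h : i < b ∧ b < j
  · rw [upperMap_apply, S.br_upper hij h.1.ne' h.2.ne, upperDefect]
    simp only [TensorProduct.add_tmul, ← TensorProduct.smul_tmul', map_add, map_smul,
      TensorProduct.assoc_tmul, ← mul_assoc]
    module
  · simp [upperDefect, S.hκ j b i h]

/-- The combination of the loops `v i a * v a i` with coefficients `κ i a j`. -/
noncomputable def loopSum (i j : Fin n) : PathAlg K n :=
  ∑ a, S.κ i a j • (pv K n i a * pv K n a i)

lemma loopSum_eq_zero {i j : Fin n} (h : i < j) : S.loopSum i j = 0 :=
  Finset.sum_eq_zero fun a _ => by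
    rw [S.hκ i a j fun h' => (h'.1.trans h'.2).not_gt h, zero_smul]

lemma sum_lowerDefect {i j : Fin n} (hij : i ≠ j) :
    ∑ a, S.lowerDefect i j a =
      lowerMap S.D (pv K n i j) (pe K n j) (pe K n i) (S.loopSum i j) := by
  simp only [S.lowerDefect_eq hij, loopSum, map_sum, map_smul]

lemma sum_upperDefect {i j : Fin n} (hij : i ≠ j) :
    ∑ b, S.upperDefect i j b =
      upperMap S.D (pv K n i j) (pe K n j) (pe K n i) (S.loopSum j i) := by
  simp only [S.upperDefect_eq hij, loopSum, map_sum, map_smul]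

lemma br_opposite {i j : Fin n} (hij : i ≠ j) :
    S.D.br (pv K n i j) (pv K n j i) =
      (if j < i then (1 : K) else -1) •
        (pe K n j ⊗ₜ pe K n i
          + (2 : K)⁻¹ • ((pv K n j i * pv K n i j) ⊗ₜ pe K n i)
          + (2 : K)⁻¹ • (pe K n j ⊗ₜ (pv K n i j * pv K n j i)))
      + pe K n j ⊗ₜ S.loopSum i j - S.loopSum j i ⊗ₜ pe K n i := by
  simp only [S.hbr_loop i j hij, loopSum, TensorProduct.tmul_sum, TensorProduct.sum_tmul,
    TensorProduct.tmul_smul, TensorProduct.smul_tmul']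

lemma tripleBr_arrow [CharZero K] {i j : Fin n} (hij : i ≠ j) :
    tripleBr S.D (pv K n i j) (pv K n i j) (pv K n j i) =
      tripleQP (pe K n) (pv K n i j) (pv K n i j) (pv K n j i)
        + ∑ a, S.lowerDefect i j a - ∑ b, S.upperDefect i j b := by
  rw [S.sum_lowerDefect hij, S.sum_upperDefect hij, tripleQP_arrow i j hij]
  refine tripleBr_of_br_eq S.D ?_ (S.hvv i j) (S.br_pe _ j) (S.br_pe _ i)
    (by simp [pv_mul_pe]) (S.br_opposite hij) (by simp [pe_mul_pv])
  rcases hij.lt_or_gt with h | h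
  · exact .inr ⟨if_neg h.not_gt, S.loopSum_eq_zero h⟩
  · exact .inl ⟨if_pos h, S.loopSum_eq_zero h⟩

lemma lowerDefect_eq_zero_of_lt {i j : Fin n} (h : i < j) (a : Fin n) :
    S.lowerDefect i j a = 0 := by
  simp [lowerDefect, S.hκ i a j fun h' => (h'.1.trans h'.2).not_gt h]

lemma upperDefect_eq_zero_of_lt {i j : Fin n} (h : j < i) (b : Fin n) :
    S.upperDefect i j b = 0 := by
  simp [upperDefect, S.hκ j b i fun h' => (h'.1.trans h'.2).not_gt h]

lemma sum_lowerDefect_eq_zero_iff {i j : Fin n} (hij : i ≠ j) :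
    ∑ a, S.lowerDefect i j a = 0 ↔ ∀ a, j < a → a < i →
      S.κ i a j * (S.β i a j - 2⁻¹) = 0 ∧ S.κ i a j * (S.μ i a j + 2⁻¹) = 0 ∧
        S.κ i a j * S.ν i a j = 0 := by
  constructor
  · intro h a hja hai
    have key (X Y : Fin n → Fin n → K) := congrArg
      (tensorFunctional (coeffRep 0 j j) (coeffRep X i j) (coeffRep Y i i)) h
    simp only [map_sum, map_add, map_smul, map_zero, lowerDefect, tensorFunctional_tmul,
      coeffRep_apply, map_mul, lineRep_pe, lineRep_pv] at key
    refine ⟨?_, ?_, ?_⟩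
    · have := key (arrowWeight K {(i, j)}) (arrowWeight K {(i, a), (a, i)})
      rw [Finset.sum_eq_single a (fun b _ hb => by
        simp +contextual [arrowWeight, hij, hai.ne', hb])
        (by simp)] at this
      simpa [arrowWeight, hij, hij.symm, hai.ne, hai.ne', hja.ne, hja.ne'] using this
    · have := key (arrowWeight K {(i, j), (i, a), (a, i)}) 0
      rw [Finset.sum_eq_single a (fun b _ hb => by
        simp +contextual [arrowWeight, hij, hij.symm, hai.ne', hja.ne, hb])
        (by simp)] at this
      simpa [arrowWeight, hij, hij.symm, hai.ne, hai.ne', hja.ne, hja.ne'] using this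
    · have := key (arrowWeight K {(i, a), (a, j)}) 0
      rw [Finset.sum_eq_single a (fun b _ hb => by
        simp +contextual [arrowWeight, hij, hai.ne', hja.ne, hb])
        (by simp)] at this
      simpa [arrowWeight, hij, hij.symm, hai.ne, hai.ne', hja.ne, hja.ne'] using this
  · intro h
    refine Finset.sum_eq_zero fun a _ => ?_
    by_cases ha : j < a ∧ a < i
    · obtain ⟨h1, h2, h3⟩ := h a ha.1 ha.2
      simp [lowerDefect, h1, h2, h3]
    · simp [lowerDefect, S.hκ i a j ha]

lemma sum_upperDefect_eq_zero_iff {i j : Fin n} (hij : i ≠ j) :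
    ∑ b, S.upperDefect i j b = 0 ↔ ∀ b, i < b → b < j →
      S.κ j b i * (S.α j i b - 2⁻¹) = 0 ∧ S.κ j b i * (S.μ j i b + 2⁻¹) = 0 ∧
        S.κ j b i * S.ν j i b = 0 := by
  constructor
  · intro h b hib hbj
    have key (X Y : Fin n → Fin n → K) := congrArg
      (tensorFunctional (coeffRep Y j j) (coeffRep X i j) (coeffRep 0 i i)) h
    simp only [map_sum, map_add, map_smul, map_zero, upperDefect, tensorFunctional_tmul,
      coeffRep_apply, map_mul, lineRep_pe, lineRep_pv] at key
    refine ⟨?_, ?_, ?_⟩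
    · have := key (arrowWeight K {(i, j)}) (arrowWeight K {(j, b), (b, j)})
      rw [Finset.sum_eq_single b (fun c _ hc => by
        simp +contextual [arrowWeight, hij, hij.symm, hbj.ne', hc])
        (by simp)] at this
      simpa [arrowWeight, hij, hij.symm, hbj.ne, hbj.ne', hib.ne, hib.ne'] using this
    · have := key (arrowWeight K {(i, j), (j, b), (b, j)}) 0
      rw [Finset.sum_eq_single b (fun c _ hc => by
        simp +contextual [arrowWeight, hij, hij.symm, hbj.ne', hib.ne, hc])
        (by simp)] at this
      simpa [arrowWeight, hij, hij.symm, hbj.ne, hbj.ne', hib.ne, hib.ne'] using this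
    · have := key (arrowWeight K {(i, b), (b, j)}) 0
      rw [Finset.sum_eq_single b (fun c _ hc => by
        simp +contextual [arrowWeight, hij, hij.symm, hbj.ne', hib.ne, hc])
        (by simp)] at this
      simpa [arrowWeight, hij, hij.symm, hbj.ne, hbj.ne', hib.ne, hib.ne'] using this
  · intro h
    refine Finset.sum_eq_zero fun b _ => ?_
    by_cases hb : i < b ∧ b < j
    · obtain ⟨h1, h2, h3⟩ := h b hb.1 hb.2
      simp [upperDefect, h1, h2, h3]
    · simp [upperDefect, S.hκ j b i hb]

end BracketData

/-- Case 3.4, Lemma 5.12. For the triple `(v_{ij}, v_{ij}, v_{ji})`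
with `i ≠ j`, the quasi-Poisson property holds iff the conditions in the applicable case
among (i), (ii) are all satisfied. -/
theorem statement_18 {𝕜 : Type} [Field 𝕜] [CharZero 𝕜] {n : ℕ}
    (S : BracketData 𝕜 n) (i j : Fin n) (hij : i ≠ j) :
    tripleBr S.D (pv 𝕜 n i j) (pv 𝕜 n i j) (pv 𝕜 n j i)
        = tripleQP (pe 𝕜 n) (pv 𝕜 n i j) (pv 𝕜 n i j) (pv 𝕜 n j i)
      ↔ ( (i < j → ∀ b, i < b → b < j →
              ( S.κ j b i * (S.α j i b - (2 : 𝕜)⁻¹) = 0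
              ∧ S.κ j b i * (S.μ j i b + (2 : 𝕜)⁻¹) = 0
              ∧ S.κ j b i * S.ν j i b = 0 ))
        ∧ (j < i → ∀ a, j < a → a < i →
              ( S.κ i a j * (S.β i a j - (2 : 𝕜)⁻¹) = 0
              ∧ S.κ i a j * (S.μ i a j + (2 : 𝕜)⁻¹) = 0
              ∧ S.κ i a j * S.ν i a j = 0 )) ) := by
  rw [S.tripleBr_arrow hij, add_sub_assoc, add_eq_left]
  rcases hij.lt_or_gt with h | h
  · rw [Finset.sum_eq_zero fun a _ => S.lowerDefect_eq_zero_of_lt h a, zero_sub, neg_eq_zero,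
      S.sum_upperDefect_eq_zero_iff hij]
    simp [h, h.not_gt]
  · rw [Finset.sum_eq_zero fun b _ => S.upperDefect_eq_zero_of_lt h b, sub_zero,
      S.sum_lowerDefect_eq_zero_iff hij]
    simp [h, h.not_gt]

end NCQP
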